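/- There exists a constant C > 0 depending only on n with the following property (Carleson type estimate): if u is continuous on B₁⁺ ∪ T₁, harmonic on B₁⁺, u ≥ 0 on B₁⁺, u = 0 on T₁, and u(eₙ/2) = 1, then u(x) ≤ C for every x ∈ B₁⸝₂⁺. -/

import Mathlib

noncomputable section

/-- The Laplacian of `u : ℝⁿ → ℝ`. -/
def lapl {m : ℕ} (u : EuclideanSpace ℝ (Fin m) → ℝ) (x : EuclideanSpace ℝ (Fin m)) : ℝ :=
  ∑ i : Fin m, fderiv ℝ (fun y => fderiv ℝ u y (EuclideanSpace.single i 1)) x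
    (EuclideanSpace.single i 1)

/-- Harmonic on an open set: C² with vanishing Laplacian. -/
def IsHarmonicOn {m : ℕ} (u : EuclideanSpace ℝ (Fin m) → ℝ)
    (U : Set (EuclideanSpace ℝ (Fin m))) : Prop :=
  ContDiffOn ℝ 2 u U ∧ ∀ x ∈ U, lapl u x = 0

/-- The unit vector `eₙ` in dimension `n + 2`. -/
def en (n : ℕ) : EuclideanSpace ℝ (Fin (n + 2)) := EuclideanSpace.single (Fin.last (n + 1)) 1

/-- The upper half ball `B_r⁺`. -/
def halfBall (n : ℕ) (r : ℝ) : Set (EuclideanSpace ℝ (Fin (n + 2))) :=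
  {x | ‖x‖ < r ∧ 0 < x (Fin.last (n + 1))}

/-- The flat boundary part `T_r`. -/
def flatT (n : ℕ) (r : ℝ) : Set (EuclideanSpace ℝ (Fin (n + 2))) :=
  {x | ‖x‖ < r ∧ x (Fin.last (n + 1)) = 0}

open MeasureTheory Filter Topology

/-- The radial weight `(1 - |y|²)₊ ^ k`. -/
def ballWeight {m : ℕ} (k : ℕ) (y : EuclideanSpace ℝ (Fin m)) : ℝ :=
  max 0 (1 - ‖y‖ ^ 2) ^ k

lemma hasDerivAt_max_zero_pow_three (s : ℝ) :
    HasDerivAt (fun s : ℝ => max 0 s ^ 3) (3 * max 0 s ^ 2) s := by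
  rcases lt_trichotomy s 0 with hs | hs | hs
  · rw [max_eq_left hs.le]
    have : (fun s : ℝ => max 0 s ^ 3) =ᶠ[𝓝 s] fun _ => 0 := by
      filter_upwards [Iio_mem_nhds hs] with t ht
      simp [max_eq_left (Set.mem_Iio.1 ht).le]
    simpa using (hasDerivAt_const s (0 : ℝ)).congr_of_eventuallyEq this
  · subst hs
    rw [hasDerivAt_iff_isLittleO_nhds_zero]
    have h3 : (fun h : ℝ => h ^ 3) =o[𝓝 0] fun h : ℝ => h ^ 1 :=
      Asymptotics.isLittleO_pow_pow (by norm_num)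
    simp only [pow_one] at h3
    refine (Asymptotics.IsBigO.of_bound 1 (Eventually.of_forall fun h => ?_)).trans_isLittleO h3
    simp only [zero_add, max_self, smul_eq_mul]
    rcases le_total h 0 with hh | hh
    · simp [max_eq_left hh]
    · simp [max_eq_right hh]
  · rw [max_eq_right hs.le]
    have : (fun s : ℝ => max 0 s ^ 3) =ᶠ[𝓝 s] fun t => t ^ 3 := by
      filter_upwards [Ioi_mem_nhds hs] with t ht
      simp only [max_eq_right (Set.mem_Ioi.1 ht).le]
    simpa using (hasDerivAt_pow 3 s).congr_of_eventuallyEq this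

section ballWeight

variable {m : ℕ} {k : ℕ}

lemma ballWeight_nonneg (y : EuclideanSpace ℝ (Fin m)) : 0 ≤ ballWeight k y :=
  pow_nonneg (le_max_left _ _) _

lemma continuous_ballWeight : Continuous (ballWeight (m := m) k) := by
  unfold ballWeight; fun_prop

lemma ballWeight_eq_zero (hk : k ≠ 0) {y : EuclideanSpace ℝ (Fin m)} (hy : 1 ≤ ‖y‖) :
    ballWeight k y = 0 := by
  unfold ballWeight
  rw [max_eq_left (by nlinarith), zero_pow hk]

lemma hasCompactSupport_ballWeight (hk : k ≠ 0) : HasCompactSupport (ballWeight (m := m) k) := by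
  refine HasCompactSupport.intro (isCompact_closedBall (0 : EuclideanSpace ℝ (Fin m)) 1) ?_
  intro y hy
  refine ballWeight_eq_zero hk ?_
  simpa using (not_le.1 (fun h => hy (mem_closedBall_zero_iff.2 h))).le

lemma hasFDerivAt_ballWeight_three (y : EuclideanSpace ℝ (Fin m)) :
    HasFDerivAt (ballWeight 3) ((-6 * ballWeight 2 y) • innerSL ℝ y) y := by
  have h1 : HasFDerivAt (fun y : EuclideanSpace ℝ (Fin m) => 1 - ‖y‖ ^ 2)
      (-(2 • innerSL ℝ y)) y := ((hasStrictFDerivAt_norm_sq y).hasFDerivAt).const_sub 1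
  have h2 := (hasDerivAt_max_zero_pow_three (1 - ‖y‖ ^ 2)).comp_hasFDerivAt y h1
  refine h2.congr_fderiv ?_
  ext v
  simp [ballWeight]
  ring

lemma integral_ballWeight_pos (hk : k ≠ 0) :
    0 < ∫ y : EuclideanSpace ℝ (Fin m), ballWeight k y := by
  refine continuous_ballWeight.integral_pos_of_hasCompactSupport_nonneg_nonzero
    (hasCompactSupport_ballWeight hk) ballWeight_nonneg (x := 0) ?_
  simp [ballWeight]

end ballWeight

lemma lapl_congr {m : ℕ} {u v : EuclideanSpace ℝ (Fin m) → ℝ} {x : EuclideanSpace ℝ (Fin m)}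
    (h : u =ᶠ[𝓝 x] v) : lapl u x = lapl v x := by
  unfold lapl
  refine Finset.sum_congr rfl fun i _ => ?_
  have : (fun y => fderiv ℝ u y (EuclideanSpace.single i 1)) =ᶠ[𝓝 x]
      fun y => fderiv ℝ v y (EuclideanSpace.single i 1) := by
    filter_upwards [h.fderiv (𝕜 := ℝ)] with y hy
    rw [hy]
  rw [this.fderiv_eq]

lemma integral_fderiv_ballWeight_eq {m : ℕ} {v : EuclideanSpace ℝ (Fin m) → ℝ}
    (hv : ContDiff ℝ 2 v) (x : EuclideanSpace ℝ (Fin m)) (t : ℝ) :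
    6 * ∫ y, fderiv ℝ v (x + t • y) y * ballWeight 2 y =
      t * ∫ y, lapl v (x + t • y) * ballWeight 3 y := by
  have hdv : ContDiff ℝ 1 (fderiv ℝ v) := hv.fderiv_right (by norm_num)
  let e : Fin m → EuclideanSpace ℝ (Fin m) := fun i => EuclideanSpace.single i 1
  let g : Fin m → EuclideanSpace ℝ (Fin m) → ℝ := fun i z => fderiv ℝ v z (e i)
  have hg : ∀ i, ContDiff ℝ 1 (g i) := fun i => hdv.clm_apply contDiff_const
  have hg' : ∀ i, Continuous fun z => fderiv ℝ (g i) z (e i) := fun i =>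
    ((hg i).continuous_fderiv (by norm_num)).clm_apply continuous_const
  have hG : ∀ i y, HasFDerivAt (fun y => g i (x + t • y)) (t • fderiv ℝ (g i) (x + t • y)) y := by
    intro i y
    have h1 : HasFDerivAt (fun y => x + t • y) (t • ContinuousLinearMap.id ℝ _) y :=
      ((hasFDerivAt_id y).const_smul t).const_add x
    have h2 := (((hg i).differentiable (by norm_num)) (x + t • y)).hasFDerivAt.comp y h1
    refine h2.congr_fderiv ?_
    ext w; simp
  have aff : Continuous fun y : EuclideanSpace ℝ (Fin m) => x + t • y := by fun_prop
  have hw : ∀ i, Continuous fun y : EuclideanSpace ℝ (Fin m) => y i := fun i => by fun_prop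
  have c2 := continuous_ballWeight (m := m) (k := 2)
  have c3 := continuous_ballWeight (m := m) (k := 3)
  have s2 := hasCompactSupport_ballWeight (m := m) (k := 2) (by norm_num)
  have s3 := hasCompactSupport_ballWeight (m := m) (k := 3) (by norm_num)
  have hgc : ∀ i, Continuous fun y => g i (x + t • y) := fun i => (hg i).continuous.comp aff
  have i1 : ∀ i, Integrable fun y => g i (x + t • y) * (-6 * (y i * ballWeight 2 y)) := fun i =>
    Continuous.integrable_of_hasCompactSupport
      ((hgc i).mul (continuous_const.mul ((hw i).mul c2)))
      (((s2.mul_left).mul_left).mul_left)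
  have i2 : ∀ i, Integrable fun y => (t * fderiv ℝ (g i) (x + t • y) (e i)) * ballWeight 3 y :=
    fun i => Continuous.integrable_of_hasCompactSupport
      ((continuous_const.mul ((hg' i).comp aff)).mul c3) s3.mul_left
  have i3 : ∀ i, Integrable fun y => g i (x + t • y) * ballWeight 3 y :=
    fun i => Continuous.integrable_of_hasCompactSupport ((hgc i).mul c3) s3.mul_left
  have key : ∀ i, ∫ y, g i (x + t • y) * (-6 * (y i * ballWeight 2 y)) =
      - ∫ y, (t * fderiv ℝ (g i) (x + t • y) (e i)) * ballWeight 3 y := by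
    intro i
    have e1 : ∀ y, fderiv ℝ (fun y => g i (x + t • y)) y (e i) =
        t * fderiv ℝ (g i) (x + t • y) (e i) := fun y => by rw [(hG i y).fderiv]; simp
    have e2 : ∀ y, fderiv ℝ (ballWeight 3) y (e i) = -6 * (y i * ballWeight 2 y) := fun y => by
      rw [(hasFDerivAt_ballWeight_three y).fderiv]
      simp [e, EuclideanSpace.inner_single_right]
      ring
    have := integral_mul_fderiv_eq_neg_fderiv_mul_of_integrable (μ := volume)
      (f := fun y => g i (x + t • y)) (g := ballWeight 3) (v := e i)
      (by simpa only [e1] using i2 i) (by simpa only [e2] using i1 i) (i3 i)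
      (fun y _ => (hG i y).differentiableAt)
      (fun y _ => (hasFDerivAt_ballWeight_three y).differentiableAt)
    simpa only [e1, e2] using this
  have hsum : ∀ y, 6 * (fderiv ℝ v (x + t • y) y * ballWeight 2 y) =
      - ∑ i, g i (x + t • y) * (-6 * (y i * ballWeight 2 y)) := by
    intro y
    have hy : y = ∑ i, y i • e i := by
      simpa [e] using ((EuclideanSpace.basisFun (Fin m) ℝ).sum_repr y).symm
    have : fderiv ℝ v (x + t • y) y = ∑ i, y i * g i (x + t • y) := by
      conv_lhs => rw [hy, map_sum]
      simp only [map_smul, smul_eq_mul, ← hy, g]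
    rw [this, Finset.sum_mul, Finset.mul_sum, ← Finset.sum_neg_distrib]
    refine Finset.sum_congr rfl fun i _ => ?_
    ring
  rw [← integral_const_mul, ← integral_const_mul]
  simp_rw [hsum]
  rw [integral_neg, integral_finsetSum _ fun i _ => i1 i]
  simp_rw [key]
  rw [Finset.sum_neg_distrib, neg_neg, ← integral_finsetSum _ fun i _ => i2 i]
  refine integral_congr_ae (Eventually.of_forall fun y => ?_)
  simp only [lapl, Finset.sum_mul, Finset.mul_sum, g, e]
  refine Finset.sum_congr rfl fun i _ => ?_
  ring

/-- Weighted mean value property for harmonic functions. -/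
lemma weighted_mean_value {m : ℕ} {v : EuclideanSpace ℝ (Fin m) → ℝ} (hv : ContDiff ℝ 2 v)
    (hvs : HasCompactSupport v) {x : EuclideanSpace ℝ (Fin m)} {r : ℝ} (hr : 0 ≤ r)
    (hl : ∀ z ∈ Metric.closedBall x r, lapl v z = 0) :
    ∫ y, v (x + r • y) * ballWeight 2 y =
      v x * ∫ y : EuclideanSpace ℝ (Fin m), ballWeight 2 y := by
  have c2 := continuous_ballWeight (m := m) (k := 2)
  have s2 := hasCompactSupport_ballWeight (m := m) (k := 2) (by norm_num)
  have hd : Continuous (fderiv ℝ v) := hv.continuous_fderiv (by norm_num)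
  obtain ⟨C, hC⟩ := (hvs.fderiv (𝕜 := ℝ)).exists_bound_of_continuous hd
  have hder : ∀ t : ℝ, HasDerivAt (fun t : ℝ => ∫ y, v (x + t • y) * ballWeight 2 y)
      (∫ y, fderiv ℝ v (x + t • y) y * ballWeight 2 y) t := by
    intro t
    refine (hasDerivAt_integral_of_dominated_loc_of_deriv_le
      (F := fun (t : ℝ) y => v (x + t • y) * ballWeight 2 y)
      (F' := fun (t : ℝ) y => fderiv ℝ v (x + t • y) y * ballWeight 2 y)
      (bound := fun y => C * ‖y‖ * ballWeight 2 y)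
      (s := Set.univ) univ_mem ?_ ?_ ?_ ?_ ?_ ?_).2
    · refine Eventually.of_forall fun s => Continuous.aestronglyMeasurable ?_
      exact (hv.continuous.comp (by fun_prop)).mul c2
    · exact Continuous.integrable_of_hasCompactSupport
        ((hv.continuous.comp (by fun_prop)).mul c2) s2.mul_left
    · refine Continuous.aestronglyMeasurable ?_
      exact ((hd.comp (by fun_prop : Continuous fun y => x + t • y)).clm_apply continuous_id).mul c2
    · refine Eventually.of_forall fun y s _ => ?_
      rw [norm_mul, Real.norm_of_nonneg (ballWeight_nonneg y)]
      gcongr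
      · exact ballWeight_nonneg y
      · exact (ContinuousLinearMap.le_opNorm _ _).trans (by gcongr; exact hC _)
    · exact Continuous.integrable_of_hasCompactSupport
        ((continuous_const.mul continuous_norm).mul c2) s2.mul_left
    · refine Eventually.of_forall fun y s _ => ?_
      have h1 : HasDerivAt (fun s : ℝ => x + s • y) y s := by
        simpa using ((hasDerivAt_id s).smul_const y).const_add x
      exact (((hv.differentiable (by norm_num)) _).hasFDerivAt.comp_hasDerivAt s h1).mul_const _
  have hzero : ∀ t ∈ Set.Ico 0 r, ∫ y, fderiv ℝ v (x + t • y) y * ballWeight 2 y = 0 := by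
    intro t ht
    have h6 := integral_fderiv_ballWeight_eq hv x t
    have h0 : ∫ y, lapl v (x + t • y) * ballWeight 3 y = 0 := by
      rw [← integral_zero (EuclideanSpace ℝ (Fin m)) ℝ]
      refine integral_congr_ae (Eventually.of_forall fun y => ?_)
      rcases le_total 1 ‖y‖ with hy | hy
      · simp [ballWeight_eq_zero (k := 3) (by norm_num) hy]
      · simp only
        rw [hl, zero_mul]
        rw [mem_closedBall_iff_norm, add_sub_cancel_left, norm_smul, Real.norm_of_nonneg ht.1]
        nlinarith [ht.1, ht.2, norm_nonneg y]
    rw [h0, mul_zero] at h6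
    linarith
  have := constant_of_has_deriv_right_zero
    (f := fun t : ℝ => ∫ y, v (x + t • y) * ballWeight 2 y) (a := 0) (b := r)
    (fun t _ => (hder t).continuousAt.continuousWithinAt)
    (fun t ht => by
      have := (hder t).hasDerivWithinAt (s := Set.Ici t)
      rwa [hzero t ht] at this) r ⟨hr, le_rfl⟩
  simp only [zero_smul, add_zero] at this
  rw [this, integral_const_mul]

lemma ballWeight_scaled_le {m : ℕ} {a w : EuclideanSpace ℝ (Fin m)} (ha : ‖a‖ ≤ 1 / 4) :
    ballWeight 2 ((4 : ℝ) • (w - a)) ≤ 2 * ballWeight 2 w := by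
  rcases le_total 1 ‖(4 : ℝ) • (w - a)‖ with h | h
  · rw [ballWeight_eq_zero (by norm_num) h]
    exact mul_nonneg (by norm_num) (ballWeight_nonneg _)
  · rw [norm_smul, Real.norm_of_nonneg (by norm_num)] at h
    have hw : ‖w‖ ≤ 1 / 2 := by
      have : ‖w‖ ≤ ‖w - a‖ + ‖a‖ := by simpa using norm_add_le (w - a) a
      linarith
    have h1 : ballWeight 2 ((4 : ℝ) • (w - a)) ≤ 1 := by
      unfold ballWeight
      exact pow_le_one₀ (le_max_left _ _)
        (max_le (by norm_num) (by linarith [sq_nonneg ‖(4 : ℝ) • (w - a)‖]))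
    have h2 : (3 / 4 : ℝ) ≤ max 0 (1 - ‖w‖ ^ 2) := by
      refine le_max_of_le_right ?_
      nlinarith [norm_nonneg w]
    have h3 : (3 / 4 : ℝ) ^ 2 ≤ ballWeight 2 w := by
      unfold ballWeight
      gcongr
    linarith

/-- Harnack inequality for compactly supported functions that are harmonic and nonnegative
on a closed ball. -/
lemma harnack_of_contDiff {m : ℕ} {v : EuclideanSpace ℝ (Fin m) → ℝ} (hv : ContDiff ℝ 2 v)
    (hvs : HasCompactSupport v) {x y : EuclideanSpace ℝ (Fin m)} {r : ℝ} (hr : 0 < r)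
    (hl : ∀ z ∈ Metric.closedBall x r, lapl v z = 0)
    (hn : ∀ z ∈ Metric.closedBall x r, 0 ≤ v z) (hxy : ‖y - x‖ ≤ r / 4) :
    v y ≤ 2 * 4 ^ m * v x := by
  have c2 := continuous_ballWeight (m := m) (k := 2)
  have s2 := hasCompactSupport_ballWeight (m := m) (k := 2) (by norm_num)
  set I := ∫ y : EuclideanSpace ℝ (Fin m), ballWeight 2 y with hI
  have hIpos : 0 < I := integral_ballWeight_pos (by norm_num)
  have hx := weighted_mean_value hv hvs hr.le hl
  have hy := weighted_mean_value hv hvs (x := y) (r := r / 4) (by positivity) (fun z hz => hl z (by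
    rw [mem_closedBall_iff_norm] at hz ⊢
    have : ‖z - x‖ ≤ ‖z - y‖ + ‖y - x‖ := by simpa using norm_add_le (z - y) (y - x)
    linarith))
  set a : EuclideanSpace ℝ (Fin m) := r⁻¹ • (y - x) with ha_def
  have ha : ‖a‖ ≤ 1 / 4 := by
    rw [ha_def, norm_smul, norm_inv, Real.norm_of_nonneg hr.le, inv_mul_le_iff₀ hr]
    linarith
  let F : EuclideanSpace ℝ (Fin m) → ℝ := fun w =>
    v (x + r • w) * ballWeight 2 ((4 : ℝ) • (w - a))
  have hF : ∫ w, v (y + (r / 4) • w) * ballWeight 2 w = 4 ^ m * ∫ w, F w := by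
    have e : ∀ w, v (y + (r / 4) • w) * ballWeight 2 w = F ((4⁻¹ : ℝ) • w + a) := by
      intro w
      have h1 : y + (r / 4) • w = x + r • ((4⁻¹ : ℝ) • w + a) := by
        rw [ha_def, smul_add, smul_smul, smul_smul, mul_inv_cancel₀ hr.ne', one_smul, div_eq_mul_inv]
        abel
      have h2 : (4 : ℝ) • ((4⁻¹ : ℝ) • w + a - a) = w := by
        rw [add_sub_cancel_right, smul_smul]; norm_num
      simp only [F]
      rw [h1, h2]
    simp_rw [e]
    rw [Measure.integral_comp_smul volume (fun w => F (w + a)) (4⁻¹ : ℝ),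
      integral_add_right_eq_self F a]
    simp
  have iF : Integrable F := by
    refine Continuous.integrable_of_hasCompactSupport
      ((hv.continuous.comp (by fun_prop)).mul (c2.comp (by fun_prop))) (HasCompactSupport.mul_left ?_)
    refine HasCompactSupport.intro
      (isCompact_closedBall (0 : EuclideanSpace ℝ (Fin m)) 1) fun w hw => ?_
    have hw0 : ballWeight 2 w = 0 := ballWeight_eq_zero (by norm_num)
      (not_le.1 (fun h => hw (mem_closedBall_zero_iff.2 h))).le
    have := ballWeight_scaled_le (w := w) ha
    rw [hw0] at this
    exact le_antisymm (by simpa using this) (ballWeight_nonneg _)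
  have hmono : ∫ w, F w ≤ ∫ w, 2 * (v (x + r • w) * ballWeight 2 w) := by
    refine integral_mono iF ?_ fun w => ?_
    · exact (Continuous.integrable_of_hasCompactSupport
        ((hv.continuous.comp (by fun_prop)).mul c2) s2.mul_left).const_mul 2
    · have hb := ballWeight_scaled_le (w := w) ha
      rcases le_total 1 ‖w‖ with hw | hw
      · rw [ballWeight_eq_zero (by norm_num) hw] at hb
        have : ballWeight 2 ((4 : ℝ) • (w - a)) = 0 :=
          le_antisymm (by simpa using hb) (ballWeight_nonneg _)
        simp [F, this, ballWeight_eq_zero (k := 2) (by norm_num) hw]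
      · have : 0 ≤ v (x + r • w) := hn _ (by
          rw [mem_closedBall_iff_norm, add_sub_cancel_left, norm_smul, Real.norm_of_nonneg hr.le]
          nlinarith)
        simp only [F]
        nlinarith [mul_le_mul_of_nonneg_left hb this]
  rw [integral_const_mul, hx] at hmono
  rw [hF] at hy
  have : v y * I ≤ (2 * 4 ^ m * v x) * I := by
    rw [← hy]
    calc (4 : ℝ) ^ m * ∫ w, F w ≤ 4 ^ m * (2 * (v x * I)) := by gcongr
      _ = _ := by ring
  exact le_of_mul_le_mul_right this hIpos

/-- Harnack inequality on a ball. -/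
lemma harnack_ball {m : ℕ} {u : EuclideanSpace ℝ (Fin m) → ℝ} {x y : EuclideanSpace ℝ (Fin m)}
    {R : ℝ} (hR : 0 < R) (hu : IsHarmonicOn u (Metric.ball x R))
    (hn : ∀ z ∈ Metric.ball x R, 0 ≤ u z) (hxy : ‖y - x‖ ≤ R / 8) :
    u y ≤ 2 * 4 ^ m * u x := by
  let χ : ContDiffBump x := ⟨5 * R / 8, 3 * R / 4, by positivity, by linarith⟩
  have hsub : tsupport χ ⊆ Metric.ball x R := by
    rw [χ.tsupport_eq]
    exact Metric.closedBall_subset_ball (by change 3 * R / 4 < R; linarith)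
  have heq : ∀ z ∈ Metric.closedBall x (R / 2), (fun z => χ z * u z) =ᶠ[𝓝 z] u := by
    intro z hz
    have : z ∈ Metric.ball x χ.rIn :=
      Metric.closedBall_subset_ball (by change R / 2 < 5 * R / 8; linarith) hz
    filter_upwards [χ.eventuallyEq_one_of_mem_ball this] with w hw
    simp [hw]
  have hsub2 : Metric.closedBall x (R / 2) ⊆ Metric.ball x R :=
    Metric.closedBall_subset_ball (by linarith)
  have key := harnack_of_contDiff (v := fun z => χ z * u z) (x := x) (y := y) (r := R / 2) ?_ ?_
    (by positivity) ?_ ?_ (by linarith)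
  · rwa [(heq x (Metric.mem_closedBall_self (by positivity))).eq_of_nhds,
      (heq y (mem_closedBall_iff_norm.2 (by linarith))).eq_of_nhds] at key
  · refine contDiff_iff_contDiffAt.2 fun z => ?_
    by_cases hz : z ∈ tsupport χ
    · exact χ.contDiffAt.mul (hu.1.contDiffAt (Metric.isOpen_ball.mem_nhds (hsub hz)))
    · refine (contDiffAt_const (c := (0 : ℝ))).congr_of_eventuallyEq ?_
      filter_upwards [notMem_tsupport_iff_eventuallyEq.1 hz] with w hw
      simp [hw]
  · exact χ.hasCompactSupport.mul_right
  · intro z hz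
    rw [lapl_congr (heq z hz)]
    exact hu.2 z (hsub2 hz)
  · intro z hz
    exact mul_nonneg χ.nonneg (hn z (hsub2 hz))

lemma second_deriv_nonpos_of_isLocalMax {g g' : ℝ → ℝ} {d t₀ : ℝ}
    (hg : ∀ᶠ t in 𝓝 t₀, HasDerivAt g (g' t) t) (hg' : HasDerivAt g' d t₀)
    (hmax : IsLocalMax g t₀) : d ≤ 0 := by
  by_contra! hd
  have he : deriv g =ᶠ[𝓝 t₀] g' := hg.mono fun t ht => ht.deriv
  have h2 : deriv (deriv g) t₀ = d := by rw [he.deriv_eq, hg'.deriv]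
  have hmin : IsLocalMin g t₀ := isLocalMin_of_deriv_deriv_pos (by rwa [h2]) hmax.deriv_eq_zero
    hg.self_of_nhds.continuousAt
  have hc : g =ᶠ[𝓝 t₀] fun _ => g t₀ := by
    filter_upwards [hmin, hmax] with t h1 h2
    exact le_antisymm h2 h1
  have : deriv (deriv g) t₀ = 0 := by
    rw [hc.deriv.deriv_eq]; simp
  linarith

/-- A function vanishing on the flat part of a half ball and harmonic inside is dominated by an
explicit barrier. -/
lemma le_barrier {n : ℕ} {u : EuclideanSpace ℝ (Fin (n + 2)) → ℝ}
    {x₀ : EuclideanSpace ℝ (Fin (n + 2))} {R M : ℝ} (hM : 0 < M)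
    (hx₀ : x₀ (Fin.last (n + 1)) = 0)
    (hcont : ContinuousOn u {y | ‖y - x₀‖ ≤ R ∧ 0 ≤ y (Fin.last (n + 1))})
    (hu : IsHarmonicOn u {y | ‖y - x₀‖ < R ∧ 0 < y (Fin.last (n + 1))})
    (hzero : ∀ y, ‖y - x₀‖ ≤ R → y (Fin.last (n + 1)) = 0 → u y = 0)
    (hle : ∀ y, ‖y - x₀‖ ≤ R → 0 ≤ y (Fin.last (n + 1)) → u y ≤ M)
    {y : EuclideanSpace ℝ (Fin (n + 2))} (hy : ‖y - x₀‖ ≤ R) (hyn : 0 ≤ y (Fin.last (n + 1))) :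
    R ^ 2 * u y ≤ M * (‖y - x₀‖ ^ 2 +
      (n + 3) * (y (Fin.last (n + 1)) * R - y (Fin.last (n + 1)) ^ 2)) := by
  set l := Fin.last (n + 1) with hl
  have hK : IsCompact {y : EuclideanSpace ℝ (Fin (n + 2)) | ‖y - x₀‖ ≤ R ∧ 0 ≤ y l} := by
    have : {y : EuclideanSpace ℝ (Fin (n + 2)) | ‖y - x₀‖ ≤ R ∧ 0 ≤ y l} =
        Metric.closedBall x₀ R ∩ {y | 0 ≤ y l} := by
      ext y; simp [dist_eq_norm]
    rw [this]
    exact (isCompact_closedBall x₀ R).inter_right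
      (isClosed_le continuous_const (by fun_prop))
  have hopen : IsOpen {y : EuclideanSpace ℝ (Fin (n + 2)) | ‖y - x₀‖ < R ∧ 0 < y l} :=
    (isOpen_lt (f := fun y : EuclideanSpace ℝ (Fin (n + 2)) => ‖y - x₀‖) (by fun_prop)
      continuous_const).and (isOpen_lt continuous_const (by fun_prop))
  let w : EuclideanSpace ℝ (Fin (n + 2)) → ℝ := fun y =>
    ‖y - x₀‖ ^ 2 + (n + 3) * (y l * R - y l ^ 2)
  let f : EuclideanSpace ℝ (Fin (n + 2)) → ℝ := fun y => R ^ 2 * u y - M * w y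
  have hfc : ContinuousOn f {y | ‖y - x₀‖ ≤ R ∧ 0 ≤ y l} :=
    (continuousOn_const.mul hcont).sub (Continuous.continuousOn (by fun_prop))
  obtain ⟨p, ⟨hp1, hp2⟩, hpmax⟩ := hK.exists_isMaxOn ⟨y, hy, hyn⟩ hfc
  suffices hfp : f p ≤ 0 by
    have : f y ≤ f p := hpmax ⟨hy, hyn⟩
    have h2 : f y ≤ 0 := this.trans hfp
    simp only [f, w] at h2
    linarith
  have hplR : p l ≤ R := by
    have h1 := PiLp.norm_apply_le (p - x₀) l
    have h2 : (p - x₀) l = p l := by simp [hx₀]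
    rw [h2] at h1
    exact (le_abs_self _).trans (h1.trans hp1)
  have hpos : 0 ≤ (n + 3 : ℝ) * (p l * R - p l ^ 2) := by
    have : 0 ≤ p l * R - p l ^ 2 := by nlinarith
    positivity
  by_contra! hfp
  rcases hp2.eq_or_lt with h0 | hpl
  · have hup := hzero p hp1 h0.symm
    have : 0 ≤ M * w p := mul_nonneg hM.le (add_nonneg (sq_nonneg _) hpos)
    simp only [f, hup] at hfp
    linarith
  rcases hp1.eq_or_lt with h0 | hpR
  · have hup := hle p hp1 hp2
    have h1 : R ^ 2 ≤ w p := by simp only [w, h0]; linarith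
    have h2 : R ^ 2 * u p ≤ R ^ 2 * M := by gcongr
    have h3 : M * R ^ 2 ≤ M * w p := by gcongr
    simp only [f] at hfp
    linarith
  have hpU : p ∈ {y : EuclideanSpace ℝ (Fin (n + 2)) | ‖y - x₀‖ < R ∧ 0 < y l} := ⟨hpR, hpl⟩
  have hloc : IsLocalMax f p := by
    filter_upwards [hopen.mem_nhds hpU] with z hz
    exact hpmax ⟨hz.1.le, hz.2.le⟩
  have hsecond : ∀ i : Fin (n + 2), R ^ 2 * fderiv ℝ
      (fun y => fderiv ℝ u y (EuclideanSpace.single i 1)) p (EuclideanSpace.single i 1) ≤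
      2 * M * (1 - (n + 3) * if i = l then 1 else 0) := by
    intro i
    let e : EuclideanSpace ℝ (Fin (n + 2)) := EuclideanSpace.single i 1
    let δ : ℝ := if i = l then 1 else 0
    have hel : e l = δ := by simp [e, δ, eq_comm]
    have he1 : ‖e‖ = 1 := by simp [e]
    let b : ℝ := 2 * inner ℝ (p - x₀) e + (n + 3) * (δ * R - 2 * p l * δ)
    have hδ : δ ^ 2 = δ := by simp only [δ]; split_ifs <;> norm_num
    have hline : ∀ t : ℝ, HasDerivAt (fun t : ℝ => p + t • e) e t := fun t => by
      simpa using ((hasDerivAt_id t).smul_const e).const_add p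
    have hw : ∀ t : ℝ, w (p + t • e) = w p + t * b + t ^ 2 * (1 - (n + 3) * δ) := by
      intro t
      have h1 : p + t • e - x₀ = (p - x₀) + t • e := by abel
      have h2 : (p + t • e) l = p l + t * δ := by simp [hel]
      simp only [w]
      rw [h1, h2, norm_add_sq_real, norm_smul, he1, inner_smul_right, mul_one,
        Real.norm_eq_abs, sq_abs]
      simp only [b]
      linear_combination (-(n + 3 : ℝ) * t ^ 2) * hδ
    have htend : Tendsto (fun t : ℝ => p + t • e) (𝓝 0) (𝓝 p) := by
      simpa using (hline 0).continuousAt.tendsto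
    have hev : ∀ᶠ t : ℝ in 𝓝 0, DifferentiableAt ℝ u (p + t • e) := by
      filter_upwards [htend.eventually (hopen.mem_nhds hpU)] with t ht
      exact (hu.1.contDiffAt (hopen.mem_nhds ht)).differentiableAt (by norm_num)
    have hd2 : DifferentiableAt ℝ (fun y => fderiv ℝ u y e) p := by
      have := ((hu.1.contDiffAt (hopen.mem_nhds hpU)).fderiv_right (m := 1)
        (by norm_num)).differentiableAt (by norm_num)
      exact this.clm_apply (differentiableAt_const _)
    have := second_deriv_nonpos_of_isLocalMax (g := fun t : ℝ => f (p + t • e))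
      (g' := fun t => R ^ 2 * fderiv ℝ u (p + t • e) e - M * (b + 2 * t * (1 - (n + 3) * δ)))
      (d := R ^ 2 * fderiv ℝ (fun y => fderiv ℝ u y e) p e - M * (2 * (1 - (n + 3) * δ)))
      (t₀ := 0) ?_ ?_ ?_
    · change R ^ 2 * fderiv ℝ (fun y => fderiv ℝ u y e) p e ≤ 2 * M * (1 - (n + 3) * δ)
      linarith
    · filter_upwards [hev] with t ht
      simp only [f, hw]
      refine ((ht.hasFDerivAt.comp_hasDerivAt t (hline t)).const_mul _).sub
        (HasDerivAt.const_mul M ?_)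
      have h1 := ((hasDerivAt_id t).mul_const b).const_add (w p)
      have h2 := ((hasDerivAt_id t).pow 2).mul_const (1 - (n + 3) * δ)
      refine (h1.add h2).congr_deriv ?_
      simp
    · refine HasDerivAt.sub (HasDerivAt.const_mul _ ?_) (HasDerivAt.const_mul M ?_)
      · have h0 : p + (0 : ℝ) • e = p := by simp
        have hd2' := hd2.hasFDerivAt
        rw [← h0] at hd2'
        have := hd2'.comp_hasDerivAt (0 : ℝ) (hline 0)
        rwa [h0] at this
      · have h1 := (((hasDerivAt_id (0 : ℝ)).const_mul 2).mul_const (1 - (n + 3) * δ)).const_add b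
        refine h1.congr_deriv ?_
        simp
    · have h0 : p + (0 : ℝ) • e = p := by simp
      have hloc' : ∀ᶠ t : ℝ in 𝓝 0, f (p + t • e) ≤ f p := htend.eventually hloc
      filter_upwards [hloc'] with t ht
      rwa [h0]
  have hsum := Finset.sum_le_sum fun i (_ : i ∈ Finset.univ) => hsecond i
  rw [← Finset.mul_sum, ← Finset.mul_sum, Finset.sum_sub_distrib, ← Finset.mul_sum] at hsum
  have hlap := hu.2 p hpU
  rw [lapl] at hlap
  rw [hlap] at hsum
  simp at hsum
  nlinarith

lemma halfBall_eq_inter (n : ℕ) (r : ℝ) :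
    halfBall n r = Metric.ball 0 r ∩ {x | 0 < x (Fin.last (n + 1))} := by
  ext x; simp [halfBall]

lemma isOpen_halfBall (n : ℕ) (r : ℝ) : IsOpen (halfBall n r) := by
  rw [halfBall_eq_inter]
  exact Metric.isOpen_ball.inter (isOpen_lt continuous_const (by fun_prop))

lemma IsHarmonicOn.mono {m : ℕ} {u : EuclideanSpace ℝ (Fin m) → ℝ}
    {U V : Set (EuclideanSpace ℝ (Fin m))} (hu : IsHarmonicOn u U) (h : V ⊆ U) :
    IsHarmonicOn u V :=
  ⟨hu.1.mono h, fun x hx => hu.2 x (h hx)⟩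

/-- Harnack chain along the segment from `eₙ / 2` to `x`. -/
lemma harnack_chain {n : ℕ} {u : EuclideanSpace ℝ (Fin (n + 2)) → ℝ}
    (hu : IsHarmonicOn u (halfBall n 1)) (hn : ∀ x ∈ halfBall n 1, 0 ≤ u x)
    (h1 : u ((2⁻¹ : ℝ) • en n) = 1) {x : EuclideanSpace ℝ (Fin (n + 2))} (hx : ‖x‖ ≤ 3 / 4)
    (hxn : 0 < x (Fin.last (n + 1))) (k : ℕ) :
    ∀ s ∈ Set.Icc (0 : ℝ) 1,
      1 + x (Fin.last (n + 1)) ≤ (101 / 100) ^ k * (1 - s + x (Fin.last (n + 1))) →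
      u ((2⁻¹ : ℝ) • en n + s • (x - (2⁻¹ : ℝ) • en n)) ≤ (2 * 4 ^ (n + 2)) ^ k := by
  set z : EuclideanSpace ℝ (Fin (n + 2)) := (2⁻¹ : ℝ) • en n with hz
  set l := Fin.last (n + 1) with hl
  set a := x l with ha
  have ha1 : a ≤ 3 / 4 := (le_abs_self _).trans ((PiLp.norm_apply_le x l).trans hx)
  have hzn : ‖z‖ = 1 / 2 := by simp [hz, en, norm_smul]
  have hzl : z l = 1 / 2 := by simp [hz, en, hl]
  have hxz : ‖x - z‖ ≤ 5 / 4 := (norm_sub_le _ _).trans (by linarith)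
  induction k with
  | zero =>
    intro s hs h
    have : s = 0 := le_antisymm (by linarith) hs.1
    simp [this, h1]
  | succ k ih =>
    intro s hs h
    set τ := 1 - s + a with hτ
    have hτ0 : 0 < τ := by linarith [hs.2]
    set τ' := min (101 / 100 * τ) (1 + a) with hτ'
    have hτ'1 : τ' ≤ 101 / 100 * τ := min_le_left _ _
    have hτ'2 : τ' ≤ 1 + a := min_le_right _ _
    have hτ'3 : τ ≤ τ' := le_min (by linarith) (by linarith [hs.1])
    set s' := 1 + a - τ' with hs'
    have hs'0 : 0 ≤ s' := by linarith
    have hs's : s' ≤ s := by linarith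
    have hs'1 : s' ≤ 1 := hs's.trans hs.2
    have hih := ih s' ⟨hs'0, hs'1⟩ (by
      have e : 1 - s' + a = τ' := by rw [hs']; ring
      rw [e]
      rcases min_choice (101 / 100 * τ) (1 + a) with hc | hc
      · rw [hτ', hc]
        calc _ ≤ _ := h
          _ = _ := by ring
      · rw [hτ', hc]
        have : (1 : ℝ) ≤ (101 / 100) ^ k := one_le_pow₀ (by norm_num)
        nlinarith)
    set p := z + s' • (x - z) with hp
    have hpn : ‖p‖ ≤ (1 - s') * (1 / 2) + s' * (3 / 4) := by
      have : p = (1 - s') • z + s' • x := by rw [hp]; module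
      rw [this]
      refine (norm_add_le _ _).trans ?_
      rw [norm_smul _ z, norm_smul _ x, Real.norm_of_nonneg (sub_nonneg.2 hs'1),
        Real.norm_of_nonneg hs'0, hzn]
      gcongr
    have hpl : τ' / 4 ≤ p l := by
      have : p l = 1 / 2 + s' * (a - 1 / 2) := by simp [hp, hzl, ha]
      rw [this, show τ' = 1 - s' + a by rw [hs']; ring]
      nlinarith
    have hball : Metric.ball p (τ' / 8) ⊆ halfBall n 1 := by
      intro y hy
      rw [mem_ball_iff_norm] at hy
      constructor
      · have : ‖y‖ ≤ ‖y - p‖ + ‖p‖ := by simpa using norm_add_le (y - p) p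
        linarith
      · have h2 := PiLp.norm_apply_le (y - p) l
        have h3 : (y - p) l = y l - p l := by simp
        rw [h3, Real.norm_eq_abs] at h2
        have := neg_abs_le (y l - p l)
        change 0 < y l
        linarith
    have hdist : ‖(z + s • (x - z)) - p‖ ≤ τ' / 8 / 8 := by
      have : (z + s • (x - z)) - p = (s - s') • (x - z) := by rw [hp]; module
      rw [this, norm_smul, Real.norm_of_nonneg (by linarith)]
      have h4 : s - s' = τ' - τ := by rw [hs', hτ]; ring
      rw [h4]
      nlinarith [norm_nonneg (x - z)]
    have hH := harnack_ball (by linarith) (hu.mono hball) (fun w hw => hn w (hball hw)) hdist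
    refine hH.trans ?_
    rw [pow_succ' (2 * 4 ^ (n + 2) : ℝ) k]
    gcongr

/-- A nonnegative harmonic function on the half ball grows at most polynomially near the flat
boundary. -/
lemma exists_polynomial_bound (n : ℕ) : ∃ (p : ℕ) (C : ℝ), 0 < C ∧
    ∀ u : EuclideanSpace ℝ (Fin (n + 2)) → ℝ, IsHarmonicOn u (halfBall n 1) →
      (∀ x ∈ halfBall n 1, 0 ≤ u x) → u ((2⁻¹ : ℝ) • en n) = 1 →
      ∀ x : EuclideanSpace ℝ (Fin (n + 2)), ‖x‖ ≤ 3 / 4 → 0 < x (Fin.last (n + 1)) →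
        u x * x (Fin.last (n + 1)) ^ p ≤ C := by
  obtain ⟨p, hp⟩ := pow_unbounded_of_one_lt (2 * 4 ^ (n + 2) : ℝ)
    (by norm_num : (1 : ℝ) < 101 / 100)
  refine ⟨p, 4 ^ p, by positivity, fun u hu hn h1 x hx hxn => ?_⟩
  set a := x (Fin.last (n + 1)) with ha
  have ha1 : a ≤ 3 / 4 := (le_abs_self _).trans ((PiLp.norm_apply_le x _).trans hx)
  obtain ⟨k, hk1, hk2⟩ := exists_nat_pow_near (x := 2 / a) (y := (101 / 100 : ℝ))
    (by rw [le_div_iff₀ hxn]; linarith) (by norm_num)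
  rw [le_div_iff₀ hxn] at hk1
  rw [div_lt_iff₀ hxn] at hk2
  have hc := harnack_chain hu hn h1 hx hxn (k + 1) 1 ⟨zero_le_one, le_rfl⟩ (by
    rw [← ha]
    linarith)
  rw [one_smul, add_sub_cancel] at hc
  calc u x * a ^ p ≤ (2 * 4 ^ (n + 2)) ^ (k + 1) * a ^ p := by gcongr
    _ ≤ ((101 / 100) ^ p) ^ (k + 1) * a ^ p := by gcongr
    _ = ((101 / 100) ^ (k + 1) * a) ^ p := by rw [mul_pow, ← pow_mul, ← pow_mul, mul_comm p]
    _ ≤ 4 ^ p := by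
      gcongr
      rw [pow_succ]
      nlinarith

theorem carleson_estimate_half_ball (n : ℕ) :
    ∃ C : ℝ, 0 < C ∧
      ∀ u : EuclideanSpace ℝ (Fin (n + 2)) → ℝ,
        ContinuousOn u (halfBall n 1 ∪ flatT n 1) →
        IsHarmonicOn u (halfBall n 1) →
        (∀ x ∈ halfBall n 1, 0 ≤ u x) →
        (∀ x ∈ flatT n 1, u x = 0) →
        u ((2⁻¹ : ℝ) • en n) = 1 →
        ∀ x ∈ halfBall n (1 / 2), u x ≤ C := by
  obtain ⟨p, C, hC, hpoly⟩ := exists_polynomial_bound n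
  set A : ℝ := n + 3 with hA
  have hA3 : 3 ≤ A := by simp [hA]
  set η : ℝ := 1 / (4 * A * 2 ^ p) with hη
  have hη0 : 0 < η := by positivity
  have h2p : (1 : ℝ) ≤ 2 ^ p := one_le_pow₀ (by norm_num)
  have hηA : 4 * A * 2 ^ p * η = 1 := by rw [hη]; field_simp
  have hη4 : η ≤ 1 / 4 := by
    have : 1 ≤ A * 2 ^ p := by nlinarith
    nlinarith
  refine ⟨C / η ^ p * 4 ^ p, by positivity, fun u hcont hu hn hzero h1 x hx => ?_⟩
  set l := Fin.last (n + 1) with hl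
  have hmem : ∀ y : EuclideanSpace ℝ (Fin (n + 2)), ‖y‖ ≤ 3 / 4 → 0 ≤ y l →
      y ∈ halfBall n 1 ∪ flatT n 1 := by
    intro y hy hyl
    rcases hyl.eq_or_lt with h | h
    · exact Or.inr ⟨by linarith, h.symm⟩
    · exact Or.inl ⟨by linarith, h⟩
  have hnn : ∀ y : EuclideanSpace ℝ (Fin (n + 2)), ‖y‖ ≤ 3 / 4 → 0 ≤ y l → 0 ≤ u y := by
    intro y hy hyl
    rcases hmem y hy hyl with h | h
    · exact hn y h
    · exact (hzero y h).ge
  have hK : IsCompact {y : EuclideanSpace ℝ (Fin (n + 2)) | ‖y‖ ≤ 3 / 4 ∧ 0 ≤ y l} := by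
    have : {y : EuclideanSpace ℝ (Fin (n + 2)) | ‖y‖ ≤ 3 / 4 ∧ 0 ≤ y l} =
        Metric.closedBall 0 (3 / 4) ∩ {y | 0 ≤ y l} := by
      ext y; simp
    rw [this]
    exact (isCompact_closedBall _ _).inter_right (isClosed_le continuous_const (by fun_prop))
  have hxK : ‖x‖ ≤ 3 / 4 ∧ 0 ≤ x l := ⟨by linarith [hx.1], hx.2.le⟩
  let F : EuclideanSpace ℝ (Fin (n + 2)) → ℝ := fun y => u y * (3 / 4 - ‖y‖) ^ p
  have hF : ContinuousOn F {y | ‖y‖ ≤ 3 / 4 ∧ 0 ≤ y l} :=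
    (hcont.mono fun y hy => hmem y hy.1 hy.2).mul (Continuous.continuousOn (by fun_prop))
  obtain ⟨q, ⟨hq1, hq2⟩, hqmax⟩ := hK.exists_isMaxOn ⟨x, hxK⟩ hF
  have hmax : ∀ y, ‖y‖ ≤ 3 / 4 → 0 ≤ y l → F y ≤ F q := fun y h1 h2 => hqmax ⟨h1, h2⟩
  suffices hM : F q ≤ C / η ^ p by
    have h3 : u x * (1 / 4) ^ p ≤ C / η ^ p := by
      refine le_trans ?_ ((hmax x hxK.1 hxK.2).trans hM)
      have := hn x ⟨by linarith [hx.1], hx.2⟩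
      have := hx.1
      simp only [F]
      gcongr
      linarith
    calc u x = u x * (1 / 4) ^ p * 4 ^ p := by rw [mul_assoc, ← mul_pow]; norm_num
      _ ≤ C / η ^ p * 4 ^ p := by gcongr
  set s := 3 / 4 - ‖q‖ with hs
  have hs0 : 0 ≤ s := by linarith
  by_contra! hlt
  have hFpos : 0 < u q * s ^ p := lt_trans (by positivity) hlt
  have huq : 0 < u q := pos_of_mul_pos_left hFpos (by positivity)
  have hql : 0 < q l := by
    refine hq2.lt_of_ne fun h => ?_
    have := hzero q ⟨by linarith, h.symm⟩
    linarith
  have hqη : q l < η * s := by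
    by_contra! hge
    have h4 := hpoly u hu hn h1 q hq1 hql
    have : u q * s ^ p ≤ C / η ^ p := by
      rw [le_div_iff₀ (by positivity), mul_assoc, ← mul_pow, mul_comm s]
      refine le_trans ?_ h4
      gcongr
    exact absurd hlt (not_lt.2 this)
  have hspos : 0 < s := by
    by_contra! h
    nlinarith
  set x₀ : EuclideanSpace ℝ (Fin (n + 2)) := q - q l • en n with hx₀
  have hx₀l : x₀ l = 0 := by simp [hx₀, en, hl]
  have hqx₀ : ‖q - x₀‖ = q l := by
    simp [hx₀, en, norm_smul, abs_of_pos hql]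
  have hnorm : ∀ y, ‖y - x₀‖ ≤ s / 4 → ‖y‖ ≤ 3 / 4 - s / 2 := by
    intro y hy
    have h5 : ‖y‖ ≤ ‖y - x₀‖ + ‖x₀ - q‖ + ‖q‖ := by
      have := norm_add₃_le (a := y - x₀) (b := x₀ - q) (c := q)
      simpa using this
    rw [norm_sub_rev x₀ q, hqx₀] at h5
    nlinarith
  have hb := le_barrier (u := u) (x₀ := x₀) (R := s / 4) (M := 2 ^ p * u q) (y := q)
    (by positivity) hx₀l
    (hcont.mono fun y hy => hmem y (by linarith [hnorm y hy.1]) hy.2)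
    (hu.mono fun y hy => ⟨by linarith [hnorm y hy.1.le], hy.2⟩)
    (fun y hy hyl => hzero y ⟨by linarith [hnorm y hy], hyl⟩)
    (fun y hy hyl => ?_) (by rw [hqx₀]; nlinarith) hql.le
  · rw [← hl, hqx₀, ← hA] at hb
    set a := q l
    have h6 : a ^ 2 + A * (a * (s / 4) - a ^ 2) ≤ A * (a * (s / 4)) := by nlinarith [sq_nonneg a]
    have h7 : A * (a * (s / 4)) < A * (η * s * (s / 4)) := by gcongr
    have h8 : 2 ^ p * u q * (a ^ 2 + A * (a * (s / 4) - a ^ 2)) <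
        2 ^ p * u q * (A * (η * s * (s / 4))) := by
      gcongr
      exact h6.trans_lt h7
    have h9 : 2 ^ p * u q * (A * (η * s * (s / 4))) = (s / 4) ^ 2 * u q := by
      linear_combination (s ^ 2 * u q / 16) * hηA
    linarith
  · have h10 := hnorm y hy
    have h11 : F y ≤ u q * s ^ p := hmax y (by linarith) hyl
    have h12 : u y * (s / 2) ^ p ≤ F y := by
      have := hnn y (by linarith) hyl
      simp only [F]
      gcongr
      linarith
    have h13 : u y * (s / 2) ^ p ≤ 2 ^ p * u q * (s / 2) ^ p := by
      refine (h12.trans h11).trans_eq ?_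
      rw [mul_right_comm, ← mul_pow, mul_div_cancel₀ s (by norm_num : (2 : ℝ) ≠ 0), mul_comm]
    exact le_of_mul_le_mul_right h13 (by positivity)
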